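/- Let K_1, …, K_d ∈ M_n(ℝ). Suppose there exist m ≥ 1 and Hermitian m×m complex matrices A_1, …, A_d with tr(A_i A_j) = δ_{ij} for all i, j, such that for every unit vector x ∈ ℂ^m the matrix ∑_{i=1}^d (x^* A_i x) K_i is entrywise nonnegative (i.e. the joint numerical range of (A_1,…,A_d) is contained in NC(K)). Then NC(K) contains a self-dual cone: there exists S ⊆ ℝ^d with S* = S and S ⊆ NC(K). -/

import Mathlib

open scoped Matrix

/-- The dual cone of a subset of `ℝ^d` with the standard inner product. -/
def dualCone {d : ℕ} (S : Set (Fin d → ℝ)) : Set (Fin d → ℝ) :=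
  {y | ∀ x ∈ S, 0 ≤ ∑ i, y i * x i}

/-- The nonnegativity cone of a tuple `K` of real `n×n` matrices:
all `v ∈ ℝ^d` such that `∑ i, v i • K i` is entrywise nonnegative. -/
def NC {n d : ℕ} (K : Fin d → Matrix (Fin n) (Fin n) ℝ) : Set (Fin d → ℝ) :=
  {v | ∀ i j, 0 ≤ ∑ q, v q * K q i j}

/-- Any set of vectors with pairwise nonnegative inner products extends to a self-dual set. -/
theorem exists_selfDual_superset {d : ℕ} (R : Set (Fin d → ℝ)) (hR : R ⊆ dualCone R) :
    ∃ S, R ⊆ S ∧ dualCone S = S := by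
  obtain ⟨S, hRS, hS⟩ := zorn_subset_nonempty {S : Set (Fin d → ℝ) | S ⊆ dualCone S} (by
    intro c hc hchain _
    refine ⟨⋃₀ c, ?_, fun s hs => Set.subset_sUnion_of_mem hs⟩
    rintro y ⟨s, hs, hy⟩ x ⟨t, ht, hx⟩
    rcases hchain.total hs ht with h | h
    · exact hc ht (h hy) x hx
    · exact hc hs hy x (h hx)) R hR
  refine ⟨S, hRS, Set.Subset.antisymm (fun y hy => hS.mem_of_prop_insert ?_) hS.prop⟩
  rintro u (rfl | hu) v (rfl | hv)
  · exact Finset.sum_nonneg fun i _ => mul_self_nonneg _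
  · exact hy v hv
  · simpa only [mul_comm] using hy u hu
  · exact hS.prop hu v hv

open scoped MatrixOrder ComplexOrder in
/-- The trace of a product of positive semidefinite complex matrices is nonnegative. -/
theorem Matrix.PosSemidef.trace_mul_nonneg {ι : Type*} [Fintype ι] [DecidableEq ι]
    {M N : Matrix ι ι ℂ} (hM : M.PosSemidef) (hN : N.PosSemidef) : 0 ≤ (M * N).trace := by
  obtain ⟨B, rfl⟩ := CStarAlgebra.nonneg_iff_eq_star_mul_self.mp hM.nonneg
  rw [Matrix.trace_mul_comm, ← Matrix.mul_assoc, Matrix.trace_mul_comm, ← Matrix.mul_assoc]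
  exact (hN.mul_mul_conjTranspose_same B).trace_nonneg

open scoped ComplexOrder in
/-- A Hermitian matrix whose quadratic form is nonnegative on unit vectors is positive
semidefinite. -/
theorem Matrix.IsHermitian.posSemidef_of_unit {ι : Type*} [Fintype ι] {M : Matrix ι ι ℂ}
    (hM : M.IsHermitian)
    (h : ∀ x : ι → ℂ, ∑ k, ‖x k‖ ^ 2 = 1 → 0 ≤ (star x ⬝ᵥ (M *ᵥ x)).re) : M.PosSemidef := by
  refine .of_dotProduct_mulVec_nonneg hM fun x => ?_
  have him : (star x ⬝ᵥ (M *ᵥ x)).im = 0 := hM.im_star_dotProduct_mulVec_self x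
  refine Complex.nonneg_iff.mpr ⟨?_, him.symm⟩
  set t := ∑ k, ‖x k‖ ^ 2 with ht
  rcases (Finset.sum_nonneg fun k _ => sq_nonneg ‖x k‖ : 0 ≤ t).eq_or_lt with h0 | hpos
  · have hx : x = 0 := by
      ext k
      simpa using (Finset.sum_eq_zero_iff_of_nonneg fun k _ => sq_nonneg ‖x k‖).mp h0.symm k
    simp [hx]
  · have hc : (Real.sqrt t)⁻¹ ^ 2 = t⁻¹ := by rw [inv_pow, Real.sq_sqrt hpos.le]
    have key := h (((Real.sqrt t)⁻¹ : ℝ) • x) (by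
      simp only [Pi.smul_apply, norm_smul, mul_pow, ← Finset.mul_sum, ← ht, Real.norm_eq_abs,
        sq_abs, hc]
      exact inv_mul_cancel₀ hpos.ne')
    rw [star_smul, star_trivial, Matrix.mulVec_smul, smul_dotProduct, dotProduct_smul, smul_smul,
      ← sq, hc, Complex.smul_re, smul_eq_mul] at key
    exact nonneg_of_mul_nonneg_right key (inv_pos.mpr hpos)

/-- Trace-orthonormality turns the trace pairing into the standard inner product. -/
theorem trace_sum_smul_mul_sum_smul {ι κ : Type*} [Fintype ι] [Fintype κ] [DecidableEq κ]
    {A : κ → Matrix ι ι ℂ} (horth : ∀ i j, (A i * A j).trace = if i = j then 1 else 0)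
    (u v : κ → ℝ) :
    ((∑ q, u q • A q) * ∑ q, v q • A q).trace = ((∑ q, u q * v q : ℝ) : ℂ) := by
  simp [Finset.sum_mul, Finset.mul_sum, Matrix.trace_sum, Matrix.trace_smul, horth, mul_comm]

open scoped ComplexOrder in
/-- Two vectors that are nonnegative on the joint numerical range of a trace-orthonormal Hermitian
tuple have nonnegative inner product. -/
theorem sum_mul_nonneg_of_nonneg_on_jointNumericalRange {ι κ : Type*} [Fintype ι] [Fintype κ]
    [DecidableEq κ] {A : κ → Matrix ι ι ℂ} (hA : ∀ i, (A i).IsHermitian)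
    (horth : ∀ i j, (A i * A j).trace = if i = j then 1 else 0) {u v : κ → ℝ}
    (hu : ∀ x : ι → ℂ, ∑ k, ‖x k‖ ^ 2 = 1 → 0 ≤ ∑ q, (star x ⬝ᵥ (A q *ᵥ x)).re * u q)
    (hv : ∀ x : ι → ℂ, ∑ k, ‖x k‖ ^ 2 = 1 → 0 ≤ ∑ q, (star x ⬝ᵥ (A q *ᵥ x)).re * v q) :
    0 ≤ ∑ q, u q * v q := by
  classical
  have hpos : ∀ w : κ → ℝ,
      (∀ x : ι → ℂ, ∑ k, ‖x k‖ ^ 2 = 1 → 0 ≤ ∑ q, (star x ⬝ᵥ (A q *ᵥ x)).re * w q) →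
      (∑ q, w q • A q).PosSemidef := fun w hw => by
    refine Matrix.IsHermitian.posSemidef_of_unit ?_ fun x hx => ?_
    · simp [Matrix.IsHermitian, Matrix.conjTranspose_sum, Matrix.conjTranspose_smul,
        fun q => (hA q).eq]
    · simpa [Matrix.sum_mulVec, dotProduct_sum, Matrix.smul_mulVec, dotProduct_smul, mul_comm]
        using hw x hx
  have h := (hpos u hu).trace_mul_nonneg (hpos v hv)
  rw [trace_sum_smul_mul_sum_smul horth] at h
  exact_mod_cast h

/-- If there are trace-orthonormal Hermitian `m×m` matrices `A 1, …, A d`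
(`m ≥ 1`) whose joint numerical range is contained in `NC(K)`, then `NC(K)` contains a
self-dual cone. -/
theorem stmt4 {n d m : ℕ} (hm : 1 ≤ m) (K : Fin d → Matrix (Fin n) (Fin n) ℝ)
    (A : Fin d → Matrix (Fin m) (Fin m) ℂ) (hA : ∀ i, (A i).IsHermitian)
    (horth : ∀ i j, (A i * A j).trace = if i = j then 1 else 0)
    (hW : ∀ x : Fin m → ℂ, ∑ k, ‖x k‖ ^ 2 = 1 →
      ∀ i j, 0 ≤ ∑ q, ((star x) ⬝ᵥ ((A q) *ᵥ x)).re * K q i j) :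
    ∃ S : Set (Fin d → ℝ), dualCone S = S ∧ S ⊆ NC K := by
  obtain ⟨S, hRS, hS⟩ := exists_selfDual_superset
    {r : Fin d → ℝ | ∃ i j, r = fun q => K q i j} (by
      rintro _ ⟨i, j, rfl⟩ _ ⟨k, l, rfl⟩
      exact sum_mul_nonneg_of_nonneg_on_jointNumericalRange hA horth
        (fun x hx => hW x hx i j) fun x hx => hW x hx k l)
  exact ⟨S, hS, fun v hv i j => hS.superset hv _ (hRS ⟨i, j, rfl⟩)⟩
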